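/- Define C(h) = Σ_{q=1}^∞ (μ²(q)/φ²(q)) c_q(h) for a positive integer h. If h is odd then C(h) = 0, and if h is even then C(h) = 2 · Π_{p>2} (1 − 1/(p−1)²) · Π_{p | h, p > 2} (p−1)/(p−2), where both products run over odd primes. -/

import Mathlib

open Finset Filter ArithmeticFunction

/-- The Ramanujan sum `c_q(n) = ∑_{k=1, gcd(k,q)=1}^{q} e^{2πi k n / q}`. -/
noncomputable def ramanujanSum (q n : ℕ) : ℂ :=
  ∑ k ∈ (Finset.Icc 1 q).filter (fun k => Nat.gcd k q = 1),
    Complex.exp (2 * Real.pi * Complex.I * k * n / q)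

/-- The singular series `C(h) = ∑_{q=1}^∞ (μ²(q)/φ²(q)) c_q(h)`.
(The term at `q = 0` vanishes since `μ(0) = 0`.) -/
noncomputable def singularSeries (h : ℕ) : ℂ :=
  ∑' q : ℕ, ((moebius q : ℂ) ^ 2 / (Nat.totient q : ℂ) ^ 2) * ramanujanSum q h

theorem ramanujanSum_eq_sum_primitiveRoots (q n : ℕ) :
    ramanujanSum q n = ∑ ζ ∈ primitiveRoots q ℂ, ζ ^ n := by
  rcases Nat.eq_zero_or_pos q with rfl | hq
  · simp [ramanujanSum]
  have hζ := Complex.isPrimitiveRoot_exp q hq.ne'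
  have : NeZero q := ⟨hq.ne'⟩
  rw [ramanujanSum]
  refine Finset.sum_bij (fun k _ => Complex.exp (2 * Real.pi * Complex.I / q) ^ k) ?_ ?_ ?_ ?_
  · intro k hk
    rw [mem_primitiveRoots hq]
    exact hζ.pow_of_coprime k (Finset.mem_filter.1 hk).2
  · intro i hi j hj hij
    simp only [Finset.mem_filter, Finset.mem_Icc] at hi hj
    obtain ⟨i, rfl⟩ := Nat.exists_eq_add_of_le' hi.1.1
    obtain ⟨j, rfl⟩ := Nat.exists_eq_add_of_le' hj.1.1
    simp only [pow_succ] at hij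
    rw [hζ.pow_inj (by omega) (by omega) (mul_right_cancel₀ (Complex.exp_ne_zero _) hij)]
  · intro ξ hξ
    rw [mem_primitiveRoots hq, hζ.isPrimitiveRoot_iff] at hξ
    obtain ⟨i, hin, hi, H⟩ := hξ
    rcases Nat.eq_zero_or_pos i with rfl | hpos
    · have hq1 : q = 1 := by simpa using hi
      subst hq1
      refine ⟨1, by simp, ?_⟩
      rw [← H, pow_zero, hζ.pow_eq_one]
    · exact ⟨i, by simp only [Finset.mem_filter, Finset.mem_Icc]; exact ⟨⟨hpos, hin.le⟩, hi⟩, H⟩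
  · intro k _
    rw [← pow_mul, ← Complex.exp_nat_mul]
    congr 1
    push_cast
    ring

theorem sum_nthRootsFinset_pow {q : ℕ} (hq : 0 < q) (n : ℕ) :
    ∑ ζ ∈ Polynomial.nthRootsFinset q (1 : ℂ), ζ ^ n = if q ∣ n then (q : ℂ) else 0 := by
  have hζ := Complex.isPrimitiveRoot_exp q hq.ne'
  set ζ := Complex.exp (2 * Real.pi * Complex.I / q)
  have : NeZero q := ⟨hq.ne'⟩
  have key : ∑ ξ ∈ Polynomial.nthRootsFinset q (1 : ℂ), ξ ^ n
      = ∑ k ∈ Finset.range q, (ζ ^ n) ^ k := by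
    symm
    refine Finset.sum_bij (fun k _ => ζ ^ k) ?_ ?_ ?_ ?_
    · intro k _
      rw [Polynomial.mem_nthRootsFinset hq, ← pow_mul, mul_comm, pow_mul, hζ.pow_eq_one, one_pow]
    · intro i hi j hj hij
      exact hζ.pow_inj (Finset.mem_range.1 hi) (Finset.mem_range.1 hj) hij
    · intro ξ hξ
      rw [Polynomial.mem_nthRootsFinset hq] at hξ
      obtain ⟨i, hi, H⟩ := hζ.eq_pow_of_pow_eq_one hξ
      exact ⟨i, Finset.mem_range.2 hi, H⟩
    · intro k _
      rw [← pow_mul, ← pow_mul, mul_comm]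
  rw [key]
  split_ifs with hd
  · simp [(hζ.pow_eq_one_iff_dvd n).2 hd]
  · have hne : ζ ^ n ≠ 1 := fun h => hd ((hζ.pow_eq_one_iff_dvd n).1 h)
    rw [geom_sum_eq hne, ← pow_mul, mul_comm, pow_mul, hζ.pow_eq_one, one_pow, sub_self, zero_div]

theorem sum_divisors_ramanujanSum {q : ℕ} (hq : 0 < q) (n : ℕ) :
    ∑ d ∈ q.divisors, ramanujanSum d n = if q ∣ n then (q : ℂ) else 0 := by
  rw [← sum_nthRootsFinset_pow hq, IsPrimitiveRoot.nthRoots_one_eq_biUnion_primitiveRoots,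
    Finset.sum_biUnion]
  · exact Finset.sum_congr rfl fun d _ => ramanujanSum_eq_sum_primitiveRoots d n
  · intro i _ j _ hij
    exact IsPrimitiveRoot.disjoint hij

theorem ramanujanSum_one (n : ℕ) : ramanujanSum 1 n = 1 := by
  simpa using sum_divisors_ramanujanSum one_pos n

theorem ramanujanSum_prime {p : ℕ} (hp : p.Prime) (n : ℕ) :
    ramanujanSum p n = if p ∣ n then (p : ℂ) - 1 else -1 := by
  have h := sum_divisors_ramanujanSum hp.pos n
  rw [hp.sum_divisors, ramanujanSum_one] at h
  split_ifs at h ⊢ <;> linear_combination h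

/-- The arithmetic function `q ↦ q` if `q ∣ n`, and `q ↦ 0` otherwise. -/
noncomputable def dvdIdFun (n : ℕ) : ArithmeticFunction ℂ :=
  ⟨fun q => if q ∣ n then (q : ℂ) else 0, by simp⟩

theorem isMultiplicative_dvdIdFun (n : ℕ) : (dvdIdFun n).IsMultiplicative := by
  refine ⟨by simp [dvdIdFun], fun {a b} hab => ?_⟩
  simp only [dvdIdFun, ArithmeticFunction.coe_mk]
  by_cases ha : a ∣ n
  · by_cases hb : b ∣ n
    · simp [ha, hb, hab.mul_dvd_of_dvd_of_dvd ha hb]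
    · have : ¬ a * b ∣ n := fun h => hb ((dvd_mul_left b a).trans h)
      simp [hb, this]
  · have : ¬ a * b ∣ n := fun h => ha ((dvd_mul_right a b).trans h)
    simp [ha, this]

/-- The Ramanujan sum `c_q(n)` as an arithmetic function of `q`. -/
noncomputable def ramanujanFun (n : ℕ) : ArithmeticFunction ℂ :=
  ⟨fun q => ramanujanSum q n, by simp [ramanujanSum]⟩

theorem ramanujanFun_eq_moebius_mul (n : ℕ) :
    ramanujanFun n = (moebius : ArithmeticFunction ℂ) * dvdIdFun n := by
  ext q
  rcases Nat.eq_zero_or_pos q with rfl | hq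
  · simp
  have h := (ArithmeticFunction.sum_eq_iff_sum_mul_moebius_eq
    (f := fun q => ramanujanSum q n) (g := fun q => if q ∣ n then (q : ℂ) else 0)).1
    (fun q hq => sum_divisors_ramanujanSum hq n) q hq
  rw [ArithmeticFunction.mul_apply]
  exact h.symm

theorem isMultiplicative_ramanujanFun (n : ℕ) : (ramanujanFun n).IsMultiplicative := by
  rw [ramanujanFun_eq_moebius_mul]
  exact isMultiplicative_moebius.intCast.mul (isMultiplicative_dvdIdFun n)

/-- The summand of the singular series as an arithmetic function. -/
noncomputable def singularTerm (h : ℕ) : ArithmeticFunction ℂ :=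
  ⟨fun q => ((moebius q : ℂ) ^ 2 / (Nat.totient q : ℂ) ^ 2) * ramanujanSum q h, by simp⟩

theorem singularTerm_apply (h q : ℕ) : singularTerm h q =
    ((moebius q : ℂ) ^ 2 / (Nat.totient q : ℂ) ^ 2) * ramanujanSum q h := rfl

theorem isMultiplicative_singularTerm (h : ℕ) : (singularTerm h).IsMultiplicative := by
  refine ⟨by simp [singularTerm_apply, ramanujanSum_one], fun {a b} hab => ?_⟩
  have hr : ramanujanSum (a * b) h = ramanujanSum a h * ramanujanSum b h :=
    (isMultiplicative_ramanujanFun h).map_mul_of_coprime hab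
  simp only [singularTerm_apply]
  rw [hr, isMultiplicative_moebius.map_mul_of_coprime hab, Nat.totient_mul hab]
  push_cast
  ring

theorem singularTerm_prime (h : ℕ) {p : ℕ} (hp : p.Prime) : singularTerm h p =
    (if p ∣ h then (p : ℂ) - 1 else -1) / ((p : ℂ) - 1) ^ 2 := by
  rw [singularTerm_apply, ramanujanSum_prime hp, moebius_apply_prime hp, Nat.totient_prime hp,
    Nat.cast_sub hp.one_le]
  push_cast
  ring

theorem singularTerm_prime_pow (h : ℕ) {p e : ℕ} (hp : p.Prime) (he : 2 ≤ e) :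
    singularTerm h (p ^ e) = 0 := by
  rw [singularTerm_apply, moebius_apply_prime_pow hp (by omega), if_neg (by omega)]
  simp

/-- A multiplicative arithmetic function vanishing at higher prime powers is absolutely summable
as soon as its values at primes are. -/
theorem summable_norm_of_isMultiplicative {f : ArithmeticFunction ℂ} (hf : f.IsMultiplicative)
    (hpow : ∀ p e : ℕ, p.Prime → 2 ≤ e → f (p ^ e) = 0)
    (hs : Summable fun p : Nat.Primes => ‖f p‖) : Summable fun n => ‖f n‖ := by
  have hmul : ∀ {m n : ℕ}, Nat.Coprime m n → ‖f (m * n)‖ = ‖f m‖ * ‖f n‖ := fun {m n} h => by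
    rw [hf.map_mul_of_coprime h, norm_mul]
  have hzero : ∀ p : ℕ, p.Prime → ∀ e ∉ Finset.range 2, ‖f (p ^ e)‖ = 0 := fun p hp e he => by
    rw [hpow p e hp (by simpa [Nat.succ_le_iff] using he), norm_zero]
  have key := EulerProduct.summable_and_hasSum_smoothNumbers_prod_primesBelow_tsum
    (f := fun n => ‖f n‖) (by simp [hf.map_one]) hmul
    (fun {p} hp => by
      simp only [norm_norm]
      exact summable_of_ne_finset_zero (s := Finset.range 2) (hzero p hp))
  refine summable_of_sum_le (c := Real.exp (∑' p : Nat.Primes, ‖f p‖))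
    (fun _ => norm_nonneg _) fun u => ?_
  obtain ⟨N, hN⟩ := u.exists_nat_subset_range
  obtain ⟨_, hhas⟩ := key N
  have hle : ∑ n ∈ u, ‖f n‖ ≤ ∏ p ∈ N.primesBelow, ∑' n : ℕ, ‖f (p ^ n)‖ := by
    have hhas' := (hasSum_subtype_iff_indicator (f := fun n => ‖f n‖)
      (s := N.smoothNumbers)).1 hhas
    refine le_trans (Finset.sum_le_sum fun n hn => ?_)
      (sum_le_hasSum u (fun n _ => Set.indicator_nonneg (fun _ _ => norm_nonneg _) n) hhas')
    rcases Nat.eq_zero_or_pos n with rfl | hn0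
    · simpa using Set.indicator_nonneg (s := N.smoothNumbers) (f := fun n => ‖f n‖)
        (fun _ _ => norm_nonneg _) 0
    · rw [Set.indicator_of_mem (Nat.mem_smoothNumbers_of_lt hn0 (Finset.mem_range.1 (hN hn)))]
  refine hle.trans ?_
  have hprod : ∏ p ∈ N.primesBelow, ∑' n : ℕ, ‖f (p ^ n)‖
      ≤ ∏ p ∈ N.primesBelow, Real.exp ‖f p‖ := by
    refine Finset.prod_le_prod (fun p _ => tsum_nonneg fun _ => norm_nonneg _) fun p hp => ?_
    rw [tsum_eq_sum (hzero p (Nat.prime_of_mem_primesBelow hp))]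
    simpa [Finset.sum_range_succ, hf.map_one, add_comm] using Real.add_one_le_exp ‖f p‖
  refine hprod.trans ?_
  rw [← Real.exp_sum]
  refine Real.exp_le_exp.2 ?_
  have hhas := (hasSum_subtype_iff_indicator (f := fun n => ‖f n‖)
      (s := {p | Nat.Prime p})).1 hs.hasSum
  refine le_trans (Finset.sum_le_sum fun p hp => ?_)
      (sum_le_hasSum N.primesBelow
        (fun n _ => Set.indicator_nonneg (fun _ _ => norm_nonneg _) n) hhas)
  exact (Set.indicator_of_mem (s := {p | Nat.Prime p}) (Nat.prime_of_mem_primesBelow hp)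
    (fun n => ‖f n‖)).ge

theorem summable_one_div_primes_sub_one_sq :
    Summable fun p : Nat.Primes => 1 / (((p : ℕ) : ℝ) - 1) ^ 2 := by
  have h : Summable fun n : ℕ => 4 * (1 / (n : ℝ) ^ 2) :=
    (Real.summable_one_div_nat_pow.2 one_lt_two).mul_left 4
  refine Summable.of_nonneg_of_le (fun p => by positivity) (fun p => ?_)
    (h.comp_injective Nat.Primes.coe_nat_injective)
  have hp : (2 : ℝ) ≤ ((p : ℕ) : ℝ) := by exact_mod_cast p.2.two_le
  simp only [Function.comp]
  rw [mul_one_div, div_le_div_iff₀ (by nlinarith) (by nlinarith)]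
  nlinarith

theorem summable_norm_singularTerm {h : ℕ} (hh : 0 < h) :
    Summable fun n => ‖singularTerm h n‖ := by
  refine summable_norm_of_isMultiplicative (isMultiplicative_singularTerm h)
    (fun p e hp he => singularTerm_prime_pow h hp he) ?_
  refine Summable.of_nonneg_of_le (fun p => norm_nonneg _) (fun p => ?_)
    (summable_one_div_primes_sub_one_sq.mul_left (h : ℝ))
  have hp : (2 : ℝ) ≤ ((p : ℕ) : ℝ) := by exact_mod_cast p.2.two_le
  have hh' : (1 : ℝ) ≤ h := by exact_mod_cast hh
  have hn : ‖((p : ℕ) : ℂ) - 1‖ = ((p : ℕ) : ℝ) - 1 := by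
    rw [← Complex.ofReal_natCast, ← Complex.ofReal_one, ← Complex.ofReal_sub,
      Complex.norm_of_nonneg (by linarith)]
  rw [singularTerm_prime h p.2, norm_div, norm_pow, hn, mul_one_div]
  gcongr
  split_ifs with hd
  · have : ((p : ℕ) : ℝ) ≤ h := by exact_mod_cast Nat.le_of_dvd hh hd
    rw [hn]
    linarith
  · simpa using hh'

theorem hasProd_singularSeries {h : ℕ} (hh : 0 < h) :
    HasProd (fun p : Nat.Primes => 1 + singularTerm h p) (singularSeries h) := by
  have hf := isMultiplicative_singularTerm h
  have hprod : HasProd (fun p : Nat.Primes => ∑' e, singularTerm h ((p : ℕ) ^ e))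
      (singularSeries h) := hf.eulerProduct_hasProd (summable_norm_singularTerm hh)
  have heq (p : Nat.Primes) : ∑' e, singularTerm h ((p : ℕ) ^ e) = 1 + singularTerm h p := by
    rw [tsum_eq_sum (s := Finset.range 2) fun e he =>
      singularTerm_prime_pow h p.2 (by simpa [Nat.succ_le_iff] using he)]
    simp [Finset.sum_range_succ, hf.map_one]
  simpa only [heq] using hprod

theorem hasProd_twinPrimeFactors :
    HasProd (fun p : Nat.Primes => if 2 < (p : ℕ) then 1 - 1 / (((p : ℕ) : ℂ) - 1) ^ 2 else 1)
      (∏' p : {p : Nat.Primes // 2 < (p : ℕ)}, (1 - 1 / (((p : ℕ) : ℂ) - 1) ^ 2)) := by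
  have hm : Multipliable fun p : Nat.Primes =>
      if 2 < (p : ℕ) then 1 - 1 / (((p : ℕ) : ℂ) - 1) ^ 2 else 1 := by
    have : Summable fun p : Nat.Primes =>
        ‖if 2 < (p : ℕ) then -(1 / (((p : ℕ) : ℂ) - 1) ^ 2) else 0‖ := by
      refine Summable.of_nonneg_of_le (fun p => norm_nonneg _) (fun p => ?_)
        summable_one_div_primes_sub_one_sq
      split_ifs
      · rw [norm_neg, norm_div, norm_pow, norm_one, ← Complex.ofReal_natCast, ← Complex.ofReal_one,
          ← Complex.ofReal_sub, Complex.norm_real, Real.norm_eq_abs, sq_abs]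
      · rw [norm_zero]
        positivity
    refine (multipliable_one_add_of_summable this).congr fun p => ?_
    split_ifs <;> ring
  have ht := tprod_subtype {p : Nat.Primes | 2 < (p : ℕ)}
    (fun p : Nat.Primes => 1 - 1 / (((p : ℕ) : ℂ) - 1) ^ 2)
  have he : Set.mulIndicator {p : Nat.Primes | 2 < (p : ℕ)}
      (fun p : Nat.Primes => 1 - 1 / (((p : ℕ) : ℂ) - 1) ^ 2) =
      fun p : Nat.Primes => if 2 < (p : ℕ) then 1 - 1 / (((p : ℕ) : ℂ) - 1) ^ 2 else 1 := by
    ext p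
    simp [Set.mulIndicator_apply]
  rw [he] at ht
  have := hm.hasProd
  rw [← ht] at this
  exact this

theorem hasProd_primes_ite_mem {s : Finset ℕ} (hs : ∀ p ∈ s, p.Prime) (g : ℕ → ℂ) :
    HasProd (fun p : Nat.Primes => if (p : ℕ) ∈ s then g p else 1) (∏ p ∈ s, g p) := by
  have h : HasProd (fun n : ℕ => if n ∈ s then g n else 1) (∏ p ∈ s, g p) := by
    have he : ∏ p ∈ s, g p = ∏ p ∈ s, if p ∈ s then g p else 1 :=
      Finset.prod_congr rfl fun p hp => (if_pos hp).symm
    rw [he]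
    exact hasProd_prod_of_ne_finset_one fun n hn => if_neg hn
  have hrange : ∀ n ∉ Set.range ((↑) : Nat.Primes → ℕ), (if n ∈ s then g n else 1) = 1 :=
    fun n hn => if_neg fun hns => hn ⟨⟨n, hs n hns⟩, rfl⟩
  exact (Nat.Primes.coe_nat_injective.hasProd_iff hrange).2 h

/-- The Hardy–Littlewood twin-prime constant: if `h` is odd then `C(h) = 0`, and if
`h` is even then `C(h) = 2 ∏_{p>2} (1 − 1/(p−1)²) · ∏_{p ∣ h, p>2} (p−1)/(p−2)`. -/
theorem singularSeries_eval (h : ℕ) (hh : 0 < h) :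
    (Odd h → singularSeries h = 0) ∧
    (Even h → singularSeries h =
      2 * (∏' p : {p : Nat.Primes // 2 < (p : ℕ)}, (1 - 1 / (((p : ℕ) : ℂ) - 1) ^ 2)) *
        ∏ p ∈ h.primeFactors.filter (fun p => 2 < p),
          (((p : ℂ) - 1) / ((p : ℂ) - 2))) := by
  have hprod := hasProd_singularSeries hh
  constructor
  · intro hodd
    refine hprod.unique (hasProd_zero_of_exists_eq_zero ⟨⟨2, Nat.prime_two⟩, ?_⟩)
    have h2 : ¬ 2 ∣ h := hodd.not_two_dvd_nat
    rw [singularTerm_prime h Nat.prime_two, if_neg h2]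
    norm_num
  · intro heven
    have h2 := hasProd_primes_ite_mem (s := {2}) (by simp [Nat.prime_two]) (fun _ => (2 : ℂ))
    have h3 := hasProd_primes_ite_mem (s := h.primeFactors.filter (fun p => 2 < p))
      (fun p hp => Nat.prime_of_mem_primeFactors (Finset.mem_filter.1 hp).1)
      (fun p => ((p : ℂ) - 1) / ((p : ℂ) - 2))
    have hall := (h2.mul hasProd_twinPrimeFactors).mul h3
    rw [Finset.prod_singleton] at hall
    refine hprod.unique ?_
    convert hall using 2 with p
    obtain ⟨p, hp⟩ := p
    simp only [Finset.mem_singleton, Finset.mem_filter, Nat.mem_primeFactors]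
    rw [singularTerm_prime h hp]
    rcases hp.two_le.eq_or_lt with rfl | hlt
    · rw [if_pos heven.two_dvd]
      norm_num
    · have hp1 : (p : ℂ) - 1 ≠ 0 := sub_ne_zero.2 (by exact_mod_cast hp.one_lt.ne')
      have hp2 : (p : ℂ) - 2 ≠ 0 := sub_ne_zero.2 (by exact_mod_cast hlt.ne')
      by_cases hd : p ∣ h
      · simp only [hd, hp, hlt, hlt.ne', hh.ne', if_true, if_false, ne_eq, not_false_eq_true,
          and_self]
        field_simp
        ring
      · simp only [hd, hp, hlt, hlt.ne', if_true, if_false, and_false, false_and]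
        field_simp
        ring
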